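/- Let λ, μ ∈ Λ^{2n+2}_k correspond to minimal length representatives v ≤ w in W^{P_k}. Then the linear form F := w_λ(ω_k) - w_μ(ω_k) (where ω_k = t_1 + ⋯ + t_k and signed permutations act on the t_i by w(t_i) = t_{w(i)} with t_{\overline{j}} := -t_j) is a nonnegative integer combination of the simple roots α_1,...,α_{n+1} of type C_{n+1}, and F ≠ 0 whenever v < w strictly. -/

import Mathlib

def bar (n : ℕ) (i : Fin (2*n+2)) : Fin (2*n+2) := ⟨2*n+1 - i, by have := i.isLt; omega⟩

def IsSigned (n : ℕ) (w : Equiv.Perm (Fin (2*n+2))) : Prop :=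
  ∀ i, w (bar n i) = bar n (w i)

def IsOddSymp (n : ℕ) (w : Equiv.Perm (Fin (2*n+2))) : Prop :=
  ∀ j : Fin (2*n+2), (j : ℕ) < n+1 → (w j : ℕ) ≠ 2*n+1

def sgen (n : ℕ) (i : Fin (n+1)) : Equiv.Perm (Fin (2*n+2)) :=
  if h : (i : ℕ) < n then
    (Equiv.swap ⟨i, by omega⟩ ⟨(i : ℕ)+1, by omega⟩) *
      (Equiv.swap ⟨2*n - i, by omega⟩ ⟨2*n+1 - i, by omega⟩)
  else Equiv.swap ⟨n, by omega⟩ ⟨n+1, by omega⟩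

noncomputable def len (n : ℕ) (w : Equiv.Perm (Fin (2*n+2))) : ℕ :=
  sInf {m | ∃ l : List (Fin (n+1)), l.length = m ∧ (l.map (sgen n)).prod = w}

def WP (n k : ℕ) : Subgroup (Equiv.Perm (Fin (2*n+2))) :=
  Subgroup.closure {x | ∃ i : Fin (n+1), (i : ℕ) ≠ k - 1 ∧ x = sgen n i}

noncomputable def IsMinRep (n k : ℕ) (w : Equiv.Perm (Fin (2*n+2))) : Prop :=
  ∀ p ∈ WP n k, len n w ≤ len n (w * p)

noncomputable def cosetLen (n k : ℕ) (w : Equiv.Perm (Fin (2*n+2))) : ℕ :=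
  sInf {m | ∃ p ∈ WP n k, len n (w * p) = m}

def s2t1 (n : ℕ) : Equiv.Perm (Fin (2*n+2)) := Equiv.swap ⟨0, by omega⟩ ⟨2*n+1, by omega⟩

def st1t2 (n : ℕ) : Equiv.Perm (Fin (2*n+2)) :=
  Equiv.swap ⟨0, by omega⟩ ⟨2*n, by omega⟩ * Equiv.swap ⟨1, by omega⟩ ⟨2*n+1, by omega⟩

/-- Bruhat order via the subword property. -/
noncomputable def BruhatLe (n : ℕ) (u w : Equiv.Perm (Fin (2*n+2))) : Prop :=
  ∃ l : List (Fin (n+1)), (l.map (sgen n)).prod = w ∧ l.length = len n w ∧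
    ∃ l' : List (Fin (n+1)), l'.Sublist l ∧ (l'.map (sgen n)).prod = u

/-- The weight `w(t_i)`: the value `w(i)` interpreted as `t_j` if unbarred and as
`-t_j` if it is `\overline j`. -/
def wtOf (n : ℕ) (m : Fin (2*n+2)) : Fin (n+1) → ℤ :=
  if h : (m : ℕ) < n+1 then Pi.single (⟨m, h⟩ : Fin (n+1)) 1
  else -Pi.single (⟨2*n+1 - m, by have := m.isLt; omega⟩ : Fin (n+1)) 1

/-- `w(ω_k) = t_{w(1)} + ⋯ + t_{w(k)}` for a signed permutation `w`. -/
def actOmega (n k : ℕ) (hk : k ≤ 2*n+2) (σ : Equiv.Perm (Fin (2*n+2))) : Fin (n+1) → ℤ :=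
  ∑ m : Fin k, wtOf n (σ (Fin.castLE hk m))

/-- The simple roots of type `C_{n+1}` (0-based): `α_i = t_i - t_{i+1}` for `i < n`,
and `α_{n+1} = 2t_{n+1}`. -/
def simpleRoot (n : ℕ) (i : Fin (n+1)) : Fin (n+1) → ℤ :=
  if h : (i : ℕ) < n then Pi.single i 1 - Pi.single (⟨(i : ℕ)+1, by omega⟩ : Fin (n+1)) 1
  else (2 : ℤ) • Pi.single i 1


abbrev pw (n : ℕ) (l : List (Fin (n+1))) : Equiv.Perm (Fin (2*n+2)) := (l.map (sgen n)).prod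

lemma bar_val (n : ℕ) (i : Fin (2*n+2)) : (bar n i : ℕ) = 2*n+1 - i := rfl

lemma bar_bar (n : ℕ) (i : Fin (2*n+2)) : bar n (bar n i) = i := by
  ext; simp only [bar_val]; omega

lemma sgen_val (n : ℕ) (i : Fin (n+1)) (j : Fin (2*n+2)) :
    (sgen n i j : ℕ) = if (j : ℕ) = i then (i : ℕ)+1 else if (j : ℕ) = i+1 then (i : ℕ)
      else if (j : ℕ) = 2*n - i then 2*n+1-i else if (j : ℕ) = 2*n+1-i then 2*n-i else j := by
  have hi := i.isLt
  have hj := j.isLt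
  unfold sgen
  split_ifs with h <;>
    simp only [Equiv.Perm.mul_apply, Equiv.swap_apply_def, Fin.ext_iff, apply_ite Fin.val] <;>
    split_ifs <;> omega

lemma sgen_sgen (n : ℕ) (i : Fin (n+1)) (j : Fin (2*n+2)) : sgen n i (sgen n i j) = j := by
  have hi := i.isLt
  have hj := j.isLt
  ext
  have h1 := sgen_val n i j
  have h2 := sgen_val n i (sgen n i j)
  split_ifs at h1 h2 <;> omega

lemma sgen_mul_self (n : ℕ) (i : Fin (n+1)) : sgen n i * sgen n i = 1 := by
  ext j; simp [sgen_sgen]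

lemma sgen_inv (n : ℕ) (i : Fin (n+1)) : (sgen n i)⁻¹ = sgen n i :=
  inv_eq_of_mul_eq_one_left (sgen_mul_self n i)

lemma sgen_signed (n : ℕ) (i : Fin (n+1)) : IsSigned n (sgen n i) := by
  intro j
  have hi := i.isLt
  have hj := j.isLt
  ext
  have h1 := sgen_val n i j
  have h2 := sgen_val n i (bar n j)
  rw [bar_val]
  rw [bar_val] at h2
  split_ifs at h1 h2 <;> omega

lemma pw_signed (n : ℕ) (l : List (Fin (n+1))) : IsSigned n (pw n l) := by
  induction l with
  | nil => intro i; simp [pw]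
  | cons a l ih =>
    intro i
    simp only [pw, List.map_cons, List.prod_cons, Equiv.Perm.mul_apply]
    rw [ih i, sgen_signed n a]

lemma signed_inv (n : ℕ) (w : Equiv.Perm (Fin (2*n+2))) (h : IsSigned n w) : IsSigned n w⁻¹ := by
  intro i
  apply w.injective
  rw [h]; simp

lemma pw_reverse (n : ℕ) (l : List (Fin (n+1))) : pw n l.reverse = (pw n l)⁻¹ := by
  induction l with
  | nil => simp [pw]
  | cons a l ih =>
    simp only [pw, List.reverse_cons, List.map_append, List.prod_append, List.map_cons,
      List.prod_cons, List.map_nil, List.prod_nil, mul_one, mul_inv_rev, sgen_inv] at ih ⊢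
    rw [ih]

/-- signed transposition -/
def tr (n : ℕ) (a b : Fin (2*n+2)) : Equiv.Perm (Fin (2*n+2)) :=
  if b = bar n a then Equiv.swap a b else Equiv.swap a b * Equiv.swap (bar n a) (bar n b)

lemma mul_tr (n : ℕ) (g : Equiv.Perm (Fin (2*n+2))) (hg : IsSigned n g) (a b : Fin (2*n+2)) :
    g * tr n a b = tr n (g a) (g b) * g := by
  unfold tr
  rw [← hg a, ← hg b]
  by_cases h : b = bar n a
  · rw [if_pos h, if_pos (by rw [h]), Equiv.mul_swap_eq_swap_mul]
  · rw [if_neg h, if_neg (fun h' => h (g.injective h')), ← mul_assoc,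
      Equiv.mul_swap_eq_swap_mul g a b, mul_assoc, Equiv.mul_swap_eq_swap_mul g, mul_assoc]

lemma tr_eq_sgen (n : ℕ) (i : Fin (n+1)) (a b : Fin (2*n+2)) (ha : (a : ℕ) = i)
    (hb : (b : ℕ) = i+1) : tr n a b = sgen n i := by
  have hi := i.isLt
  unfold tr sgen
  by_cases h : (i : ℕ) < n
  · rw [dif_pos h, if_neg (by rw [Fin.ext_iff, bar_val]; omega), Equiv.swap_comm (bar n a)]
    congr 2 <;> ext <;> simp [bar_val] <;> omega
  · rw [dif_neg h, if_pos (by rw [Fin.ext_iff, bar_val]; omega)]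
    congr 1 <;> ext <;> simp <;> omega

lemma tr_bar (n : ℕ) (a b : Fin (2*n+2)) : tr n (bar n b) (bar n a) = tr n a b := by
  unfold tr
  simp only [bar_bar]
  by_cases h : b = bar n a
  · subst h; simp [bar_bar]
  · have h' : ¬ bar n a = b := fun e => h e.symm
    rw [if_neg h, if_neg h']
    ext x
    rw [Equiv.swap_comm b a, Equiv.swap_comm (bar n b)]
    by_cases hab : a = b
    · subst hab; simp
    have e1 : a ≠ bar n a := by rw [Ne, Fin.ext_iff, bar_val]; omega
    have e2 : b ≠ bar n b := by rw [Ne, Fin.ext_iff, bar_val]; omega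
    have e3 : a ≠ bar n b := by intro e; apply h; rw [e, bar_bar]
    have e4 : bar n a ≠ bar n b := by
      intro e; apply hab; rw [← bar_bar n a, e, bar_bar]
    simp only [Equiv.Perm.mul_apply, Equiv.swap_apply_def]
    congr 1
    grind

lemma exch (n : ℕ) (l : List (Fin (n+1))) : ∀ a b : Fin (2*n+2), a < b →
    (pw n l)⁻¹ b < (pw n l)⁻¹ a →
    ∃ l' : List (Fin (n+1)), l'.length + 1 = l.length ∧ pw n l' = tr n a b * pw n l := by
  induction l with
  | nil => intro a b hab h; simp [pw] at h; exact absurd h (not_lt.mpr hab.le)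
  | cons j l ih =>
    intro a b hab h
    have hc : pw n (j :: l) = sgen n j * pw n l := by simp [pw]
    rw [hc, mul_inv_rev, sgen_inv, Equiv.Perm.mul_apply, Equiv.Perm.mul_apply] at h
    by_cases hs : sgen n j a < sgen n j b
    · obtain ⟨l', h1, h2⟩ := ih _ _ hs h
      refine ⟨j :: l', by simp [h1], ?_⟩
      have hc' : pw n (j :: l') = sgen n j * pw n l' := by simp [pw]
      rw [hc', hc, h2, ← mul_assoc, mul_tr n _ (sgen_signed n j), sgen_sgen, sgen_sgen, mul_assoc]
    · refine ⟨l, by simp, ?_⟩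
      have : tr n a b = sgen n j := by
        have h1 := sgen_val n j a
        have h2 := sgen_val n j b
        have hj := j.isLt
        have hb := b.isLt
        rw [Fin.lt_def] at hab hs
        have : ((a : ℕ) = j ∧ (b : ℕ) = j+1) ∨ ((a : ℕ) = 2*n-j ∧ (b : ℕ) = 2*n+1-j) := by
          split_ifs at h1 h2 <;> omega
        rcases this with ⟨h3, h4⟩ | ⟨h3, h4⟩
        · exact tr_eq_sgen n j a b h3 h4
        · rw [← tr_bar]
          exact tr_eq_sgen n j _ _ (by rw [bar_val]; omega) (by rw [bar_val]; omega)
      rw [this, hc, ← mul_assoc, sgen_mul_self, one_mul]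

/-! Gale order on finite sets -/

def rk (A : Finset ℕ) (a : ℕ) : ℕ := (A.filter (fun x => a ≤ x)).card

lemma rk_succ (A : Finset ℕ) (a : ℕ) : rk A a = rk A (a+1) + if a ∈ A then 1 else 0 := by
  unfold rk
  have : A.filter (fun x => a ≤ x) = A.filter (fun x => a+1 ≤ x) ∪ A.filter (fun x => x = a) := by
    ext x; simp only [Finset.mem_filter, Finset.mem_union]
    constructor
    · rintro ⟨h, h'⟩
      by_cases e : x = a
      · exact Or.inr ⟨h, e⟩
      · exact Or.inl ⟨h, by omega⟩
    · rintro (⟨h, h'⟩ | ⟨h, h'⟩) <;> exact ⟨h, by omega⟩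
  rw [this, Finset.card_union_of_disjoint]
  · congr 1
    rw [Finset.filter_eq']
    split_ifs <;> simp
  · rw [Finset.disjoint_filter]; intros; omega

def sw (i : ℕ) (A : Finset ℕ) : Finset ℕ := A.map (Equiv.swap i (i+1)).toEmbedding

lemma mem_sw (i : ℕ) (A : Finset ℕ) (x : ℕ) : x ∈ sw i A ↔ Equiv.swap i (i+1) x ∈ A := by
  unfold sw
  rw [Finset.mem_map_equiv, Equiv.symm_swap]

lemma rk_sw (i : ℕ) (A : Finset ℕ) (a : ℕ) (ha : a ≠ i+1) : rk (sw i A) a = rk A a := by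
  unfold rk sw
  rw [Finset.filter_map, Finset.card_map]
  congr 1
  apply Finset.filter_congr
  intro x _
  simp only [Function.comp, Equiv.coe_toEmbedding, Equiv.swap_apply_def]
  split_ifs <;> omega

lemma rk_sw' (i : ℕ) (A : Finset ℕ) :
    rk (sw i A) (i+1) = rk A (i+2) + if i ∈ A then 1 else 0 := by
  rw [rk_succ, rk_sw i A _ (by omega)]
  simp [mem_sw]

def Gale (A B : Finset ℕ) : Prop := ∀ a, rk A a ≤ rk B a

lemma Gale_lift (i : ℕ) (A B : Finset ℕ) (h : Gale A B) (hB : i+1 ∈ B → i ∈ B) :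
    Gale (sw i A) (sw i B) := by
  intro a
  by_cases ha : a = i+1
  · subst ha
    rw [rk_sw', rk_sw']
    have h1 := h (i+2)
    have h2 := h i
    have a1 := rk_succ A i
    have a2 := rk_succ A (i+1)
    have b1 := rk_succ B i
    have b2 := rk_succ B (i+1)
    simp only [add_assoc, Nat.reduceAdd] at a2 b2
    by_cases c1 : i ∈ A <;> by_cases c2 : i ∈ B <;> by_cases c3 : i+1 ∈ B <;>
      simp_all <;> omega
  · rw [rk_sw _ _ _ ha, rk_sw _ _ _ ha]; exact h a

lemma Gale_up (i : ℕ) (B : Finset ℕ) (hB : i+1 ∈ B → i ∈ B) : Gale B (sw i B) := by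
  intro a
  by_cases ha : a = i+1
  · subst ha
    rw [rk_sw']
    have b2 := rk_succ B (i+1)
    by_cases c2 : i ∈ B <;> by_cases c3 : i+1 ∈ B <;> simp_all
  · rw [rk_sw _ _ _ ha]

lemma Gale_trans {A B C : Finset ℕ} (h : Gale A B) (h' : Gale B C) : Gale A C :=
  fun a => (h a).trans (h' a)

/-- The set of first `k` values. -/
def SS (n k : ℕ) (w : Equiv.Perm (Fin (2*n+2))) : Finset ℕ :=
  (Finset.univ.filter (fun m : Fin (2*n+2) => (m : ℕ) < k)).map
    (w.toEmbedding.trans Fin.valEmbedding)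

lemma mem_SS (n k : ℕ) (w : Equiv.Perm (Fin (2*n+2))) (x : Fin (2*n+2)) :
    (x : ℕ) ∈ SS n k w ↔ (w⁻¹ x : ℕ) < k := by
  simp only [SS, Finset.mem_map, Finset.mem_filter, Finset.mem_univ, true_and,
    Function.Embedding.trans_apply, Equiv.coe_toEmbedding, Fin.valEmbedding_apply]
  constructor
  · rintro ⟨m, h, e⟩
    have : x = w m := Fin.ext e.symm
    rw [this]; simpa using h
  · intro h; exact ⟨w⁻¹ x, h, by simp⟩

lemma SS_lt (n k : ℕ) (w : Equiv.Perm (Fin (2*n+2))) (x : ℕ) (h : x ∈ SS n k w) : x < 2*n+2 := by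
  simp only [SS, Finset.mem_map, Finset.mem_filter, Finset.mem_univ, true_and,
    Function.Embedding.trans_apply, Equiv.coe_toEmbedding, Fin.valEmbedding_apply] at h
  obtain ⟨m, -, e⟩ := h
  omega

lemma SS_sgen (n k : ℕ) (i : Fin (n+1)) (w : Equiv.Perm (Fin (2*n+2))) :
    SS n k (sgen n i * w) =
      if (i : ℕ) < n then sw i (sw (2*n-i) (SS n k w)) else sw i (SS n k w) := by
  have hi := i.isLt
  have key : ∀ x : Fin (2*n+2), (x : ℕ) ∈ SS n k (sgen n i * w) ↔
      (sgen n i x : ℕ) ∈ SS n k w := by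
    intro x
    rw [mem_SS, mem_SS, mul_inv_rev, sgen_inv, Equiv.Perm.mul_apply]
  ext x
  by_cases hx : x < 2*n+2
  · have h1 := key ⟨x, hx⟩
    simp only at h1
    rw [h1, sgen_val]
    simp only
    split_ifs <;> simp only [mem_sw] <;>
      (apply iff_of_eq; congr 1; simp only [Equiv.swap_apply_def]; split_ifs <;> omega)
  · have h1 : x ∉ SS n k (sgen n i * w) := fun h => hx (SS_lt _ _ _ _ h)
    have h2 : x ∉ SS n k w := fun h => hx (SS_lt _ _ _ _ h)
    have e1 : Equiv.swap (i : ℕ) (i+1) x = x :=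
      Equiv.swap_apply_of_ne_of_ne (by omega) (by omega)
    have e2 : Equiv.swap (2*n-i : ℕ) (2*n-i+1) x = x :=
      Equiv.swap_apply_of_ne_of_ne (by omega) (by omega)
    split_ifs <;> simp only [mem_sw, e1, e2] <;> tauto

lemma Gale_step (n k : ℕ) (i : Fin (n+1)) (w : Equiv.Perm (Fin (2*n+2))) (hw : IsSigned n w)
    (hlt : ∀ a b : Fin (2*n+2), (a : ℕ) = i → (b : ℕ) = i+1 → w⁻¹ a < w⁻¹ b) :
    Gale (SS n k w) (SS n k (sgen n i * w)) ∧
    ∀ u, Gale (SS n k u) (SS n k w) → Gale (SS n k (sgen n i * u)) (SS n k (sgen n i * w)) := by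
  have hi := i.isLt
  have h1 : (i : ℕ)+1 ∈ SS n k w → (i : ℕ) ∈ SS n k w := by
    have a1 := mem_SS n k w ⟨i, by omega⟩
    have a2 := mem_SS n k w ⟨i+1, by omega⟩
    have a3 := hlt ⟨i, by omega⟩ ⟨i+1, by omega⟩ rfl rfl
    simp only [Fin.lt_def] at a1 a2 a3
    rw [a1, a2]; omega
  have h2 : (2*n-i : ℕ)+1 ∈ SS n k w → (2*n-i : ℕ) ∈ SS n k w := by
    have a1 := mem_SS n k w (bar n ⟨i, by omega⟩)
    have a2 := mem_SS n k w (bar n ⟨i+1, by omega⟩)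
    have a3 := hlt ⟨i, by omega⟩ ⟨i+1, by omega⟩ rfl rfl
    rw [signed_inv n w hw, bar_val, bar_val] at a1 a2
    simp only [Fin.lt_def] at a1 a2 a3
    rw [show (2*n-i : ℕ)+1 = 2*n+1-i by omega, show (2*n-i : ℕ) = 2*n+1-(i+1) by omega, a1, a2]
    omega
  simp only [SS_sgen]
  by_cases h : (i : ℕ) < n
  · simp only [if_pos h]
    have h3 : (i : ℕ)+1 ∈ sw (2*n-i) (SS n k w) → (i : ℕ) ∈ sw (2*n-i) (SS n k w) := by
      rw [mem_sw, mem_sw, Equiv.swap_apply_of_ne_of_ne (by omega) (by omega),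
        Equiv.swap_apply_of_ne_of_ne (by omega) (by omega)]
      exact h1
    exact ⟨Gale_trans (Gale_up _ _ h2) (Gale_up _ _ h3), fun u hu => Gale_lift _ _ _ (Gale_lift _ _ _ hu h2) h3⟩
  · simp only [if_neg h]
    exact ⟨Gale_up _ _ h1, fun u hu => Gale_lift _ _ _ hu h1⟩

lemma Gale_sub (n k : ℕ) (l : List (Fin (n+1))) :
    (∀ l2, pw n l2 = pw n l → l.length ≤ l2.length) →
    ∀ l', l'.Sublist l → Gale (SS n k (pw n l')) (SS n k (pw n l)) := by
  induction l with
  | nil => intro _ l' h; rw [List.sublist_nil.mp h]; exact fun a => le_rfl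
  | cons i l ih =>
    intro hred l' hl'
    have hc : ∀ l, pw n (i :: l) = sgen n i * pw n l := fun l => by simp [pw]
    have hred' : ∀ l2, pw n l2 = pw n l → l.length ≤ l2.length := by
      intro l2 h2
      have := hred (i :: l2) (by rw [hc, hc, h2])
      simpa using this
    have hstep := Gale_step n k i (pw n l) (pw_signed n l) (by
      intro a b ha hb
      by_contra hcon
      have hne : (pw n l)⁻¹ a ≠ (pw n l)⁻¹ b := by
        intro e; have := (pw n l)⁻¹.injective e; rw [this] at ha; omega
      obtain ⟨l2, e1, e2⟩ := exch n l a b (by rw [Fin.lt_def]; omega)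
        (lt_of_le_of_ne (not_lt.mp hcon) hne.symm)
      rw [tr_eq_sgen n i a b ha hb, ← hc] at e2
      have := hred l2 e2
      simp at this
      omega)
    rw [hc]
    cases hl' with
    | cons _ h => exact Gale_trans (ih hred' _ h) hstep.1
    | cons_cons _ h => rw [hc]; exact hstep.2 _ (ih hred' _ h)

lemma len_spec (n : ℕ) (w : Equiv.Perm (Fin (2*n+2))) (l : List (Fin (n+1))) (h : pw n l = w) :
    len n w ≤ l.length := Nat.sInf_le ⟨l, rfl, h⟩

lemma len_ex (n : ℕ) (w : Equiv.Perm (Fin (2*n+2))) (l : List (Fin (n+1))) (h : pw n l = w) :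
    ∃ l' : List (Fin (n+1)), l'.length = len n w ∧ pw n l' = w := 
  Nat.sInf_mem (s := {m | ∃ l : List (Fin (n+1)), l.length = m ∧ (l.map (sgen n)).prod = w})
    ⟨_, l, rfl, h⟩

/-! Weights -/

lemma wtOf_apply (n : ℕ) (m : Fin (2*n+2)) (j : Fin (n+1)) :
    wtOf n m j = (if (m : ℕ) = j then 1 else 0) - (if (m : ℕ) = 2*n+1-j then 1 else 0) := by
  have hj := j.isLt
  have hm := m.isLt
  unfold wtOf
  split_ifs <;> simp only [Pi.neg_apply, Pi.single_apply, Fin.ext_iff] <;>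
    (try split_ifs) <;> first | omega | simp

lemma sum_ind (n k : ℕ) (hk : k ≤ 2*n+2) (w : Equiv.Perm (Fin (2*n+2))) (x : ℕ) :
    (∑ m : Fin k, if (w (Fin.castLE hk m) : ℕ) = x then (1 : ℤ) else 0) =
      if x ∈ SS n k w then 1 else 0 := by
  by_cases h : x ∈ SS n k w
  · rw [if_pos h]
    have h' := mem_SS n k w ⟨x, SS_lt _ _ _ _ h⟩
    simp only [h, true_iff] at h'
    rw [Finset.sum_eq_single ⟨_, h'⟩]
    · simp [Fin.castLE]
    · intro m _ hm
      rw [if_neg]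
      intro e
      apply hm
      ext
      simp only [← e]
      simp
    · simp
  · rw [if_neg h]
    apply Finset.sum_eq_zero
    intro m _
    rw [if_neg]
    intro e
    apply h
    rw [← e, mem_SS]
    simp

lemma actOmega_apply (n k : ℕ) (hk : k ≤ 2*n+2) (w : Equiv.Perm (Fin (2*n+2))) (j : Fin (n+1)) :
    actOmega n k hk w j = (if (j : ℕ) ∈ SS n k w then 1 else 0)
      - (if 2*n+1-(j : ℕ) ∈ SS n k w then 1 else 0) := by
  unfold actOmega
  rw [Finset.sum_apply]
  simp only [wtOf_apply, Finset.sum_sub_distrib, sum_ind]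

lemma comb_apply (n : ℕ) (c : ℕ → ℤ) (j : Fin (n+1)) :
    (∑ i : Fin (n+1), c i • simpleRoot n i) j =
      c j * (if (j : ℕ) < n then 1 else 2) - (if (j : ℕ) = 0 then 0 else c (j-1)) := by
  have hj := j.isLt
  have h1 : ∀ i : Fin (n+1), (c i • simpleRoot n i) j =
      (if i = j then c j * (if (j : ℕ) < n then 1 else 2) else 0) -
      (if (i : ℕ)+1 = j then c (j-1) else 0) := by
    intro i
    have hi := i.isLt
    unfold simpleRoot
    by_cases h : (i : ℕ) < n
    · rw [dif_pos h]
      simp only [Pi.smul_apply, Pi.sub_apply, Pi.single_apply, smul_eq_mul, Fin.ext_iff]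
      by_cases e1 : (i : ℕ) = j
      · have e2 : ¬ ((j : ℕ) = i + 1) := by omega
        have e3 : ¬ ((i : ℕ) + 1 = j) := by omega
        have e4 : (j : ℕ) < n := by omega
        rw [if_pos e1.symm, if_neg e2, if_pos e1, if_neg e3, if_pos e4, e1]; ring
      · have e0 : ¬ ((j : ℕ) = i) := by omega
        rw [if_neg e0, if_neg e1]
        by_cases e2 : (i : ℕ) + 1 = j
        · rw [if_pos e2, if_pos e2.symm, ← e2]; simp
        · rw [if_neg e2, if_neg (Ne.symm e2)]; simp
    · rw [dif_neg h]
      have e3 : ¬ ((i : ℕ) + 1 = j) := by omega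
      simp only [Pi.smul_apply, Pi.single_apply, smul_eq_mul, Fin.ext_iff]
      rw [if_neg e3]
      by_cases e1 : (i : ℕ) = j
      · have e4 : ¬ (j : ℕ) < n := by omega
        rw [if_pos e1.symm, if_pos e1, if_neg e4, e1]; ring
      · rw [if_neg e1, if_neg (Ne.symm e1)]; simp
  rw [Finset.sum_apply]
  simp only [h1, Finset.sum_sub_distrib]
  congr 1
  · simp
  · by_cases h0 : (j : ℕ) = 0
    · rw [if_pos h0]; apply Finset.sum_eq_zero; intro i _; rw [if_neg]; omega
    · rw [if_neg h0, Finset.sum_eq_single ⟨j-1, by omega⟩]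
      · rw [if_pos]; simp; omega
      · intro i _ hi
        rw [if_neg]; intro e; apply hi; ext; simp; omega
      · simp

lemma rk_zero (n k : ℕ) (v : Equiv.Perm (Fin (2*n+2))) :
    rk (SS n k v) 0 = (Finset.univ.filter (fun m : Fin (2*n+2) => (m : ℕ) < k)).card := by
  simp [rk, SS]

lemma rk_top (n k : ℕ) (v : Equiv.Perm (Fin (2*n+2))) : rk (SS n k v) (2*n+2) = 0 := by
  unfold rk
  rw [Finset.card_eq_zero, Finset.filter_eq_empty_iff]
  intro x hx
  have := SS_lt _ _ _ _ hx
  omega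

lemma part1 (n k : ℕ) (hk : k ≤ 2*n+2) (v w : Equiv.Perm (Fin (2*n+2)))
    (h : Gale (SS n k v) (SS n k w)) :
    actOmega n k hk v - actOmega n k hk w ∈ AddSubmonoid.closure (Set.range (simpleRoot n)) := by
  set D : ℕ → ℤ := fun a => (rk (SS n k w) a : ℤ) - rk (SS n k v) a with hD
  have hD0 : ∀ a, 0 ≤ D a := fun a => by have := h a; simp only [hD]; omega
  set c : ℕ → ℤ := fun j => if j < n then D (j+1) + D (2*n+1-j) else D (n+1) with hc
  have hc0 : ∀ j, 0 ≤ c j := by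
    intro j
    have := hD0 (j+1)
    have := hD0 (2*n+1-j)
    have := hD0 (n+1)
    simp only [hc]; split_ifs <;> omega
  have hDs : ∀ a, ((if a ∈ SS n k v then 1 else 0 : ℤ) - if a ∈ SS n k w then 1 else 0) =
      D (a+1) - D a := by
    intro a
    have h1 := rk_succ (SS n k v) a
    have h2 := rk_succ (SS n k w) a
    simp only [hD]
    split_ifs at h1 h2 ⊢ <;> omega
  have hF : actOmega n k hk v - actOmega n k hk w = ∑ i : Fin (n+1), c i • simpleRoot n i := by
    ext j
    have hj := j.isLt
    rw [comb_apply, Pi.sub_apply, actOmega_apply, actOmega_apply]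
    have e1 := hDs j
    have e2 := hDs (2*n+1-j)
    have d0 : D 0 = 0 := by simp [hD, rk_zero]
    have d1 : D (2*n+2) = 0 := by simp [hD, rk_top]
    rw [show 2*n+1-(j : ℕ)+1 = 2*n+2-j by omega] at e2
    simp only [hc]
    by_cases j0 : (j : ℕ) = 0
    · simp only [j0, if_true] at e1 e2 ⊢
      by_cases n0 : 0 < n
      · simp only [if_pos n0]; simp at e1 e2 ⊢; linarith
      · have : n = 0 := by omega
        subst this
        simp at e1 e2 d1 ⊢; linarith
    · rw [if_neg j0, if_pos (show (j : ℕ) - 1 < n by omega), show (j : ℕ)-1+1 = j by omega,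
        show 2*n+1-((j : ℕ)-1) = 2*n+2-j by omega]
      by_cases jn : (j : ℕ) < n
      · simp only [if_pos jn]; linarith
      · have : (j : ℕ) = n := by omega
        rw [if_neg jn, if_neg jn]
        rw [this] at e1 e2 ⊢
        rw [show 2*n+1-n = n+1 by omega] at e2 ⊢
        linarith
  rw [hF]
  apply AddSubmonoid.sum_mem
  intro i _
  have : c i • simpleRoot n i = (c i).toNat • simpleRoot n i := by
    rw [← natCast_zsmul, Int.toNat_of_nonneg (hc0 i)]
  rw [this]
  exact AddSubmonoid.nsmul_mem _ (AddSubmonoid.subset_closure (Set.mem_range_self i)) _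

/-! Minimal representatives -/

lemma min_step (n k : ℕ) (w : Equiv.Perm (Fin (2*n+2))) (hmin : IsMinRep n k w)
    (l : List (Fin (n+1))) (hl : pw n l = w) (i : Fin (n+1)) (hi : (i : ℕ) ≠ k-1)
    (a b : Fin (2*n+2)) (ha : (a : ℕ) = i) (hb : (b : ℕ) = i+1) : w a < w b := by
  by_contra hcon
  have hne : w a ≠ w b := by
    intro e; have := w.injective e; rw [this] at ha; omega
  obtain ⟨l1, h1, h2⟩ := len_ex n w l hl
  obtain ⟨l2, e1, e2⟩ := exch n l1.reverse a b (by rw [Fin.lt_def]; omega) (by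
    rw [pw_reverse, inv_inv, h2]; exact lt_of_le_of_ne (not_lt.mp hcon) hne.symm)
  rw [tr_eq_sgen n i a b ha hb, pw_reverse, h2] at e2
  have h3 := hmin (sgen n i) (Subgroup.subset_closure ⟨i, hi, rfl⟩)
  have h4 := len_spec n (w * sgen n i) l2.reverse (by
    rw [pw_reverse, e2, mul_inv_rev, inv_inv, sgen_inv])
  simp only [List.length_reverse] at e1 h4
  omega

lemma min_step' (n k : ℕ) (hk : 1 ≤ k) (w : Equiv.Perm (Fin (2*n+2)))
    (hs : IsSigned n w) (hmin : IsMinRep n k w)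
    (l : List (Fin (n+1))) (hl : pw n l = w)
    (a b : Fin (2*n+2)) (hab : (b : ℕ) = a+1) (h1 : (b : ℕ) ≠ k) (h2 : (b : ℕ) ≠ 2*n+2-k) :
    w a < w b := by
  have hb := b.isLt
  by_cases h : (a : ℕ) < n+1
  · exact min_step n k w hmin l hl ⟨a, h⟩ (by simp; omega) a b rfl hab
  · have := min_step n k w hmin l hl ⟨2*n+1-b, by omega⟩ (by simp; omega) (bar n b) (bar n a)
      (by simp [bar_val]) (by simp [bar_val]; omega)
    rw [hs, hs, Fin.lt_def, bar_val, bar_val] at this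
    rw [Fin.lt_def]; omega

lemma min_mono (n k : ℕ) (hk : 1 ≤ k) (w : Equiv.Perm (Fin (2*n+2)))
    (hs : IsSigned n w) (hmin : IsMinRep n k w)
    (l : List (Fin (n+1))) (hl : pw n l = w) (d : ℕ) :
    ∀ a b : Fin (2*n+2), (b : ℕ) = a+1+d → (∀ c, (a : ℕ) < c → c ≤ b → c ≠ k ∧ c ≠ 2*n+2-k) →
    w a < w b := by
  induction d with
  | zero =>
    intro a b hab h
    have := h b (by omega) le_rfl
    exact min_step' n k hk w hs hmin l hl a b hab this.1 this.2
  | succ d ih =>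
    intro a b hab h
    have hb := b.isLt
    have h1 := ih a ⟨b-1, by omega⟩ (by simp; omega)
      (fun c hc hc' => h c hc (by simp at hc'; omega))
    have := h b (by omega) le_rfl
    exact h1.trans (min_step' n k hk w hs hmin l hl _ b (by simp; omega) this.1 this.2)

lemma SS_anti (n k : ℕ) (hkn : k ≤ n+1) (w : Equiv.Perm (Fin (2*n+2)))
    (hs : IsSigned n w) (x : Fin (2*n+2)) : ¬ ((x : ℕ) ∈ SS n k w ∧ (bar n x : ℕ) ∈ SS n k w) := by
  rw [mem_SS, mem_SS, signed_inv n w hs, bar_val]; omega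

lemma SS_eq (n k : ℕ) (hkn : k ≤ n+1) (hk' : k ≤ 2*n+2) (v w : Equiv.Perm (Fin (2*n+2)))
    (hvs : IsSigned n v) (hws : IsSigned n w)
    (h : actOmega n k hk' v = actOmega n k hk' w) (x : Fin (2*n+2)) :
    (x : ℕ) ∈ SS n k v ↔ (x : ℕ) ∈ SS n k w := by
  have hx := x.isLt
  have a1 := SS_anti n k hkn v hvs x
  have a2 := SS_anti n k hkn w hws x
  rw [bar_val] at a1 a2
  by_cases hn : (x : ℕ) < n+1
  · have e := congrFun h ⟨x, hn⟩
    rw [actOmega_apply, actOmega_apply] at e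
    simp only at e
    split_ifs at e <;> first | tauto | omega
  · have e := congrFun h ⟨2*n+1-x, by omega⟩
    rw [actOmega_apply, actOmega_apply] at e
    simp only [show 2*n+1-(2*n+1-(x : ℕ)) = x by omega] at e
    split_ifs at e <;> first | tauto | omega

lemma part2 (n k : ℕ) (hk : 1 ≤ k) (hkn : k ≤ n+1) (hk' : k ≤ 2*n+2)
    (v w : Equiv.Perm (Fin (2*n+2)))
    (hvs : IsSigned n v) (hws : IsSigned n w)
    (hvmin : IsMinRep n k v) (hwmin : IsMinRep n k w)
    (lv lw : List (Fin (n+1))) (hlv : pw n lv = v) (hlw : pw n lw = w)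
    (h : actOmega n k hk' v = actOmega n k hk' w) : v = w := by
  set x : Equiv.Perm (Fin (2*n+2)) := v⁻¹ * w with hx
  have hvx : ∀ j, v (x j) = w j := fun j => by simp [hx]
  have hxs : IsSigned n x := by
    intro j; apply v.injective; rw [hvx, hvs, hvx, hws]
  have hblock : ∀ j, ((x j : ℕ) < k ↔ (j : ℕ) < k) := by
    intro j
    have := SS_eq n k hkn hk' v w hvs hws h (w j)
    rw [mem_SS, mem_SS] at this
    simpa [hx] using this
  have hblock' : ∀ j, ((x j : ℕ) < 2*n+2-k ↔ (j : ℕ) < 2*n+2-k) := by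
    intro j
    have := hblock (bar n j)
    rw [hxs, bar_val, bar_val] at this
    have h1 := j.isLt
    have h2 := (x j).isLt
    omega
  have hmono : StrictMono (x : Fin (2*n+2) → Fin (2*n+2)) := by
    have hstep : ∀ a b : Fin (2*n+2), (b : ℕ) = a + 1 → x a < x b := by
      intro a b hab
      have p1 := hblock a
      have p2 := hblock b
      have p3 := hblock' a
      have p4 := hblock' b
      rw [Fin.lt_def]
      by_cases c1 : (b : ℕ) = k
      · omega
      by_cases c2 : (b : ℕ) = 2*n+2-k
      · omega
      have hw1 := min_step' n k hk w hws hwmin lw hlw a b hab c1 c2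
      by_contra hcon
      have hne : x a ≠ x b := by
        intro e; have := x.injective e; rw [this] at hab; omega
      have hne' : (x a : ℕ) ≠ x b := fun e => hne (Fin.ext e)
      have := min_mono n k hk v hvs hvmin lv hlv ((x a : ℕ) - x b - 1) (x b) (x a) (by omega)
        (by intro c hc hc'; omega)
      rw [hvx, hvx] at this
      exact absurd hw1 (not_lt.mpr this.le)
    exact Fin.strictMono_iff_lt_succ.mpr (fun i => hstep _ _ (by simp))
  have hx1 : x = 1 := by
    ext j
    have : (x : Fin (2*n+2) → Fin (2*n+2)) = id :=
      (StrictMono.range_inj hmono strictMono_id).mp (by rw [x.surjective.range_eq, Set.range_id])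
    rw [this]; simp
  rw [hx] at hx1
  exact (inv_mul_eq_one.mp hx1)

/-- For `v ≤ w` in `W^{P_k}` (Bruhat order), the linear form
`F = v(ω_k) - w(ω_k)` is a nonnegative integer combination of the simple roots of type
`C_{n+1}`, and `F ≠ 0` whenever `v < w` strictly. -/
theorem stmt18 (n k : ℕ) (hk : 1 ≤ k) (hkn : k ≤ n+1)
    (v w : Equiv.Perm (Fin (2*n+2)))
    (hvs : IsSigned n v) (hws : IsSigned n w)
    (hvmin : IsMinRep n k v) (hwmin : IsMinRep n k w)
    (hvw : BruhatLe n v w) :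
    actOmega n k (by omega) v - actOmega n k (by omega) w ∈
        AddSubmonoid.closure (Set.range (simpleRoot n)) ∧
      (v ≠ w → actOmega n k (by omega) v - actOmega n k (by omega) w ≠ 0) := by
  obtain ⟨l, hl, hlen, l', hsub, hl'⟩ := hvw
  refine ⟨part1 n k _ v w ?_, fun hne h0 => hne ?_⟩
  · have := Gale_sub n k l (fun l2 h2 => by
      rw [hlen]; exact len_spec n w l2 (h2.trans hl)) l' hsub
    rwa [show pw n l = w from hl, show pw n l' = v from hl'] at this
  · exact part2 n k hk hkn _ v w hvs hws hvmin hwmin l' l hl' hl (sub_eq_zero.mp h0)
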